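/- Let Φ denote the standard normal CDF and logit(p) = log p − log(1−p) for p ∈ (0,1). Let θ, δ_L, δ_U, b be real numbers with δ_L < δ_U, θ ≠ δ_L, θ ≠ δ_U, and let σ > 0. Set a_U = (δ_U − θ)/σ and a_L = (δ_L − θ)/σ, and define f(t) = Φ(a_U√t + b) − Φ(a_L√t + b) for t > 0. Then the derivative of t ↦ logit(f(t)) converges, as t → ∞, to (1/2 − 𝟙{θ ∉ (δ_L, δ_U)}) · min{a_U², a_L²}, where 𝟙{θ ∉ (δ_L, δ_U)} equals 1 if θ lies outside the open interval (δ_L, δ_U) and 0 otherwise. (This is the unified statement of Theorem 1(b) of the paper for finite interval endpoints.) -/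

import Mathlib

open Filter Real

/-- The standard normal CDF: Φ(x) = ∫_{−∞}^{x} e^{−t²/2}/√(2π) dt. -/
noncomputable def stdNormCDF (x : ℝ) : ℝ :=
  ∫ t in Set.Iic x, Real.exp (-t ^ 2 / 2) / Real.sqrt (2 * Real.pi)

/-- logit(p) = log p − log(1−p). -/
noncomputable def logit (p : ℝ) : ℝ := Real.log p - Real.log (1 - p)

open MeasureTheory Topology

/-- The standard normal density. -/
noncomputable def stdNormPDF (x : ℝ) : ℝ := exp (-x ^ 2 / 2) / √(2 * π)

lemma stdNormPDF_pos (x : ℝ) : 0 < stdNormPDF x := by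
  unfold stdNormPDF; positivity

lemma stdNormPDF_neg (x : ℝ) : stdNormPDF (-x) = stdNormPDF x := by
  simp [stdNormPDF]

lemma stdNormPDF_eq_gaussianPDFReal :
    stdNormPDF = ProbabilityTheory.gaussianPDFReal 0 1 := by
  ext x
  simp [stdNormPDF, ProbabilityTheory.gaussianPDFReal, div_eq_inv_mul]

lemma integrable_stdNormPDF : Integrable stdNormPDF := by
  rw [stdNormPDF_eq_gaussianPDFReal]
  exact ProbabilityTheory.integrable_gaussianPDFReal 0 1

lemma integral_stdNormPDF : ∫ x, stdNormPDF x = 1 := by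
  rw [stdNormPDF_eq_gaussianPDFReal]
  exact ProbabilityTheory.integral_gaussianPDFReal_eq_one 0 one_ne_zero

lemma continuous_stdNormPDF : Continuous stdNormPDF := by
  unfold stdNormPDF; fun_prop

lemma hasDerivAt_stdNormPDF (x : ℝ) : HasDerivAt stdNormPDF (-x * stdNormPDF x) x := by
  have h := (((hasDerivAt_pow 2 x).neg.div_const 2).exp).div_const √(2 * π)
  refine h.congr_deriv ?_
  simp [stdNormPDF]
  ring

lemma stdNormCDF_eq (x : ℝ) : stdNormCDF x = ∫ t in Set.Iic x, stdNormPDF t := rfl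

lemma hasDerivAt_stdNormCDF (x : ℝ) : HasDerivAt stdNormCDF (stdNormPDF x) x := by
  have h : stdNormCDF = fun y => stdNormCDF 0 + ∫ t in (0 : ℝ)..y, stdNormPDF t := by
    ext y
    rw [← intervalIntegral.integral_Iic_sub_Iic integrable_stdNormPDF.integrableOn
      integrable_stdNormPDF.integrableOn, stdNormCDF_eq, stdNormCDF_eq]
    ring
  rw [h]
  exact (continuous_stdNormPDF.integral_hasStrictDerivAt 0 x).hasDerivAt.const_add _

lemma stdNormCDF_pos (x : ℝ) : 0 < stdNormCDF x := by
  rw [stdNormCDF_eq, setIntegral_pos_iff_support_of_nonneg_ae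
    (Eventually.of_forall fun t => (stdNormPDF_pos t).le) integrable_stdNormPDF.integrableOn]
  have : Function.support stdNormPDF = Set.univ :=
    Set.eq_univ_of_forall fun t => (stdNormPDF_pos t).ne'
  simp [this]

lemma tendsto_stdNormCDF_atBot : Tendsto stdNormCDF atBot (𝓝 0) :=
  tendsto_integral_Iic_zero tendsto_id

lemma stdNormCDF_eq_one_sub (x : ℝ) : stdNormCDF x = 1 - stdNormCDF (-x) := by
  have h := intervalIntegral.integral_Iic_add_Ioi
    (integrable_stdNormPDF.integrableOn (s := Set.Iic x)) integrable_stdNormPDF.integrableOn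
  have h' := integral_comp_neg_Iic (-x) stdNormPDF
  simp only [stdNormPDF_neg, neg_neg] at h'
  rw [integral_stdNormPDF, ← h'] at h
  rw [stdNormCDF_eq, stdNormCDF_eq]
  linarith

lemma hasDerivAt_stdNormCDF_neg (x : ℝ) :
    HasDerivAt (fun y => stdNormCDF (-y)) (-stdNormPDF x) x := by
  have h := (hasDerivAt_stdNormCDF (-x)).comp x (hasDerivAt_neg x)
  simpa [Function.comp_def, stdNormPDF_neg] using h

lemma tendsto_stdNormCDF_neg : Tendsto (fun x => stdNormCDF (-x)) atTop (𝓝 0) :=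
  tendsto_stdNormCDF_atBot.comp tendsto_neg_atTop_atBot

lemma tendsto_stdNormPDF_atTop : Tendsto stdNormPDF atTop (𝓝 0) := by
  have h : Tendsto (fun x : ℝ => -x ^ 2 / 2) atTop atBot :=
    (tendsto_neg_atTop_atBot.comp (tendsto_pow_atTop two_ne_zero)).atBot_div_const two_pos
  have h' := (tendsto_exp_atBot.comp h).div_const √(2 * π)
  rwa [zero_div] at h'

/-- The asymptotics of the Mills ratio of the standard normal distribution. -/
lemma tendsto_stdNormPDF_div_stdNormCDF_neg :
    Tendsto (fun x => stdNormPDF x / x / stdNormCDF (-x)) atTop (𝓝 1) := by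
  refine HasDerivAt.lhopital_zero_atTop
    (f' := fun x => (-x * stdNormPDF x * x - stdNormPDF x * 1) / x ^ 2)
    (g' := fun x => -stdNormPDF x) ?_
    (Eventually.of_forall hasDerivAt_stdNormCDF_neg)
    (Eventually.of_forall fun x => neg_ne_zero.2 (stdNormPDF_pos x).ne')
    (tendsto_stdNormPDF_atTop.div_atTop tendsto_id) tendsto_stdNormCDF_neg ?_
  · filter_upwards [eventually_ne_atTop 0] with x hx
    exact (hasDerivAt_stdNormPDF x).div (hasDerivAt_id x) hx
  · have h : Tendsto (fun x : ℝ => 1 + (x ^ 2)⁻¹) atTop (𝓝 1) := by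
      simpa using (tendsto_inv_atTop_zero.comp
        (tendsto_pow_atTop (α := ℝ) two_ne_zero)).const_add 1
    refine h.congr' ?_
    filter_upwards [eventually_ne_atTop 0] with x hx
    have := (stdNormPDF_pos x).ne'
    field_simp
    ring

/-- `G` is eventually positive, tends to `0` at infinity, and its logarithmic derivative
tends to `L`. -/
def DecaysWithRate (G G' : ℝ → ℝ) (L : ℝ) : Prop :=
  (∀ᶠ t in atTop, HasDerivAt G (G' t) t) ∧ (∀ᶠ t in atTop, 0 < G t) ∧
    Tendsto G atTop (𝓝 0) ∧ Tendsto (fun t => G' t / G t) atTop (𝓝 L)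

namespace DecaysWithRate

variable {G G' H H' : ℝ → ℝ} {L M : ℝ}

lemma add (hG : DecaysWithRate G G' L) (hH : DecaysWithRate H H' L) :
    DecaysWithRate (fun t => G t + H t) (fun t => G' t + H' t) L := by
  obtain ⟨dG, pG, tG, rG⟩ := hG
  obtain ⟨dH, pH, tH, rH⟩ := hH
  refine ⟨?_, ?_, by simpa using tG.add tH, ?_⟩
  · filter_upwards [dG, dH] with t h1 h2 using h1.add h2
  · filter_upwards [pG, pH] with t h1 h2 using add_pos h1 h2
  · rw [tendsto_iff_norm_sub_tendsto_zero] at rG rH ⊢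
    refine squeeze_zero' (Eventually.of_forall fun t => norm_nonneg _) ?_
      (by simpa using rG.add rH)
    filter_upwards [pG, pH] with t h1 h2
    have key : (G' t + H' t) / (G t + H t) - L =
        G t / (G t + H t) * (G' t / G t - L) + H t / (G t + H t) * (H' t / H t - L) := by
      field_simp
      ring
    have w1 : ‖G t / (G t + H t)‖ ≤ 1 := by
      rw [Real.norm_of_nonneg (by positivity), div_le_one (by positivity)]; linarith
    have w2 : ‖H t / (G t + H t)‖ ≤ 1 := by
      rw [Real.norm_of_nonneg (by positivity), div_le_one (by positivity)]; linarith
    rw [key]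
    refine (norm_add_le _ _).trans (add_le_add ?_ ?_)
    · rw [norm_mul]; exact mul_le_of_le_one_left (norm_nonneg _) w1
    · rw [norm_mul]; exact mul_le_of_le_one_left (norm_nonneg _) w2

lemma add_const_mul_of_tendsto_div (hG : DecaysWithRate G G' L) (hH : DecaysWithRate H H' M)
    (hHG : Tendsto (fun t => H t / G t) atTop (𝓝 0)) (c : ℝ) :
    DecaysWithRate (fun t => G t + c * H t) (fun t => G' t + c * H' t) L := by
  obtain ⟨dG, pG, tG, rG⟩ := hG
  obtain ⟨dH, pH, tH, rH⟩ := hH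
  have hden : Tendsto (fun t => 1 + c * (H t / G t)) atTop (𝓝 1) := by
    simpa using (hHG.const_mul c).const_add 1
  have hdenpos := hden.eventually_const_lt one_pos
  refine ⟨?_, ?_, by simpa using tG.add (tH.const_mul c), ?_⟩
  · filter_upwards [dG, dH] with t h1 h2 using h1.add (h2.const_mul c)
  · filter_upwards [pG, hdenpos] with t h1 h2
    have : G t + c * H t = G t * (1 + c * (H t / G t)) := by field_simp
    rw [this]
    positivity
  · have h := (rG.add ((rH.mul hHG).const_mul c)).div hden one_ne_zero
    simp only [mul_zero, add_zero, div_one] at h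
    refine h.congr' ?_
    filter_upwards [pG, pH, hdenpos] with t h1 h2 h3
    have e : G t + c * H t = G t * (1 + c * (H t / G t)) := by field_simp
    simp only [Pi.div_apply]
    rw [e, ← div_div]
    congr 1
    field_simp

lemma tendsto_deriv_logit (hG : DecaysWithRate G G' L) :
    Tendsto (deriv fun t => logit (G t)) atTop (𝓝 L) := by
  obtain ⟨dG, pG, tG, rG⟩ := hG
  have h := rG.div (tG.const_sub 1) (by norm_num)
  simp only [sub_zero, div_one] at h
  refine h.congr' ?_
  filter_upwards [dG, pG, tG.eventually_lt_const one_pos] with t d p l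
  have h1 : 1 - G t ≠ 0 := by linarith
  have h2 := (d.log p.ne').sub ((d.const_sub 1).log h1)
  have h3 : HasDerivAt (fun t => logit (G t)) (G' t / G t - -G' t / (1 - G t)) t := h2
  rw [h3.deriv]
  simp only [Pi.div_apply]
  field_simp
  ring

lemma tendsto_deriv_logit_one_sub (hG : DecaysWithRate G G' L) :
    Tendsto (deriv fun t => logit (1 - G t)) atTop (𝓝 (-L)) := by
  have h : (fun t => logit (1 - G t)) = fun t => -logit (G t) := by
    ext t; simp [logit]
  rw [h]
  refine hG.tendsto_deriv_logit.neg.congr fun t => ?_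
  rw [deriv.fun_neg]

end DecaysWithRate

/-- The normal upper tail probability beyond `a * √t + b`. -/
noncomputable def normTail (a b t : ℝ) : ℝ := stdNormCDF (-(a * √t + b))

/-- The derivative of `normTail a b`. -/
noncomputable def normTailDeriv (a b t : ℝ) : ℝ :=
  -stdNormPDF (a * √t + b) * (a * (1 / (2 * √t)))

lemma hasDerivAt_normTail (a b : ℝ) {t : ℝ} (ht : 0 < t) :
    HasDerivAt (normTail a b) (normTailDeriv a b t) t :=
  HasDerivAt.comp (h₂ := fun y => stdNormCDF (-y)) t
    (hasDerivAt_stdNormCDF_neg (a * √t + b)) (((Real.hasDerivAt_sqrt ht.ne').const_mul a).add_const b)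

lemma tendsto_mul_sqrt_add {a : ℝ} (ha : 0 < a) (b : ℝ) :
    Tendsto (fun t => a * √t + b) atTop atTop :=
  tendsto_atTop_add_const_right _ _ (tendsto_sqrt_atTop.const_mul_atTop ha)

lemma tendsto_normTail {a : ℝ} (ha : 0 < a) (b : ℝ) : Tendsto (normTail a b) atTop (𝓝 0) :=
  tendsto_stdNormCDF_neg.comp (tendsto_mul_sqrt_add ha b)

lemma decaysWithRate_normTail {a : ℝ} (ha : 0 < a) (b : ℝ) :
    DecaysWithRate (normTail a b) (normTailDeriv a b) (-(a ^ 2 / 2)) := by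
  refine ⟨?_, Eventually.of_forall fun t => stdNormCDF_pos _, tendsto_normTail ha b, ?_⟩
  · filter_upwards [eventually_gt_atTop 0] with t ht using hasDerivAt_normTail a b ht
  have hu := tendsto_mul_sqrt_add ha b
  have h1 := tendsto_stdNormPDF_div_stdNormCDF_neg.comp hu
  have h2 : Tendsto (fun t => a + b / √t) atTop (𝓝 a) := by
    simpa using (tendsto_sqrt_atTop.const_div_atTop b).const_add a
  have h := ((h1.mul h2).mul_const (a / 2)).neg
  rw [show -(1 * a * (a / 2)) = -(a ^ 2 / 2) by ring] at h
  refine h.congr' ?_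
  filter_upwards [eventually_gt_atTop 0, hu.eventually_gt_atTop 0] with t ht hut
  have hs : 0 < √t := Real.sqrt_pos.2 ht
  have hc := stdNormCDF_pos (-(a * √t + b))
  simp only [Function.comp_apply, normTailDeriv, normTail]
  field_simp

lemma tendsto_normTail_div {a₁ a₂ : ℝ} (h₁ : 0 < a₁) (h₂ : a₁ < a₂) (b₁ b₂ : ℝ) :
    Tendsto (fun t => normTail a₂ b₂ t / normTail a₁ b₁ t) atTop (𝓝 0) := by
  have h₃ : 0 < a₂ := h₁.trans h₂
  refine HasDerivAt.lhopital_zero_atTop (decaysWithRate_normTail h₃ b₂).1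
    (decaysWithRate_normTail h₁ b₁).1 ?_ (tendsto_normTail h₃ b₂) (tendsto_normTail h₁ b₁) ?_
  · filter_upwards [eventually_gt_atTop 0] with t ht
    have := stdNormPDF_pos (a₁ * √t + b₁)
    have hs : 0 < √t := Real.sqrt_pos.2 ht
    have : 0 < stdNormPDF (a₁ * √t + b₁) * (a₁ * (1 / (2 * √t))) := by positivity
    rw [normTailDeriv, neg_mul]
    exact neg_ne_zero.2 this.ne'
  have hd := tendsto_mul_sqrt_add (sub_pos.2 h₂) (b₂ - b₁)
  have hs := tendsto_mul_sqrt_add (add_pos h₁ h₃) (b₁ + b₂)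
  have he := tendsto_exp_atBot.comp
    ((tendsto_neg_atTop_atBot.comp (hd.atTop_mul_atTop₀ hs)).atBot_div_const two_pos)
  have h := he.mul_const (a₂ / a₁)
  rw [zero_mul] at h
  refine h.congr' ?_
  filter_upwards [eventually_gt_atTop 0] with t ht
  have hs : 0 < √t := Real.sqrt_pos.2 ht
  have hexp : -(((a₂ - a₁) * √t + (b₂ - b₁)) * ((a₁ + a₂) * √t + (b₁ + b₂))) / 2 =
      -(a₂ * √t + b₂) ^ 2 / 2 - -(a₁ * √t + b₁) ^ 2 / 2 := by ring
  simp only [Function.comp_apply, normTailDeriv, stdNormPDF]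
  rw [hexp, Real.exp_sub]
  field_simp

lemma decaysWithRate_normTail_sub {a₁ a₂ : ℝ} (h₁ : 0 < a₁) (h₂ : a₁ < a₂) (b₁ b₂ : ℝ) :
    ∃ G', DecaysWithRate (fun t => normTail a₁ b₁ t - normTail a₂ b₂ t) G' (-(a₁ ^ 2 / 2)) := by
  have h := (decaysWithRate_normTail h₁ b₁).add_const_mul_of_tendsto_div
    (decaysWithRate_normTail (h₁.trans h₂) b₂) (tendsto_normTail_div h₁ h₂ b₁ b₂) (-1)
  simp only [neg_one_mul, ← sub_eq_add_neg] at h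
  exact ⟨_, h⟩

lemma decaysWithRate_normTail_add {a₁ a₂ : ℝ} (h₁ : 0 < a₁) (h₂ : 0 < a₂) (b₁ b₂ : ℝ) :
    ∃ G', DecaysWithRate (fun t => normTail a₁ b₁ t + normTail a₂ b₂ t) G'
      (-(min (a₁ ^ 2) (a₂ ^ 2) / 2)) := by
  wlog hle : a₁ ≤ a₂ generalizing a₁ a₂ b₁ b₂
  · simpa only [add_comm, min_comm] using this h₂ h₁ b₂ b₁ (le_of_not_ge hle)
  rw [min_eq_left (pow_le_pow_left₀ h₁.le hle 2)]
  rcases hle.eq_or_lt with rfl | hlt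
  · exact ⟨_, (decaysWithRate_normTail h₁ b₁).add (decaysWithRate_normTail h₁ b₂)⟩
  · have h := (decaysWithRate_normTail h₁ b₁).add_const_mul_of_tendsto_div
      (decaysWithRate_normTail h₂ b₂) (tendsto_normTail_div h₁ hlt b₁ b₂) 1
    simp only [one_mul] at h
    exact ⟨_, h⟩

/-- Unified Theorem 1(b) with finite endpoints: with a_U = (δ_U − θ)/σ,
a_L = (δ_L − θ)/σ, and f(t) = Φ(a_U√t + b) − Φ(a_L√t + b), the derivative of
t ↦ logit(f(t)) converges as t → ∞ to
(1/2 − 𝟙{θ ∉ (δ_L, δ_U)})·min{a_U², a_L²}. -/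
theorem stmt10 (θ δL δU b σ : ℝ) (hδ : δL < δU) (hL : θ ≠ δL) (hU : θ ≠ δU)
    (hσ : 0 < σ) :
    Tendsto
      (deriv fun t : ℝ =>
        logit (stdNormCDF ((δU - θ) / σ * Real.sqrt t + b) -
          stdNormCDF ((δL - θ) / σ * Real.sqrt t + b)))
      atTop
      (nhds ((1 / 2 - (if θ ∉ Set.Ioo δL δU then (1 : ℝ) else 0)) *
        min (((δU - θ) / σ) ^ 2) (((δL - θ) / σ) ^ 2))) := by
  have haLU : (δL - θ) / σ < (δU - θ) / σ := by gcongr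
  have hL' : 0 < (δL - θ) / σ ↔ θ < δL := by rw [div_pos_iff_of_pos_right hσ, sub_pos]
  have hU' : 0 < (δU - θ) / σ ↔ θ < δU := by rw [div_pos_iff_of_pos_right hσ, sub_pos]
  have hL0 : (δL - θ) / σ ≠ 0 := div_ne_zero (sub_ne_zero.2 hL.symm) hσ.ne'
  have hU0 : (δU - θ) / σ ≠ 0 := div_ne_zero (sub_ne_zero.2 hU.symm) hσ.ne'
  generalize (δL - θ) / σ = l at *
  generalize (δU - θ) / σ = u at *
  have hneg (a t : ℝ) : stdNormCDF (a * √t + b) = normTail (-a) (-b) t := by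
    rw [normTail]; congr 1; ring
  have hpos (a t : ℝ) : stdNormCDF (a * √t + b) = 1 - normTail a b t :=
    stdNormCDF_eq_one_sub _
  rcases hL.lt_or_gt with hlt | hgt
  · have hl := hL'.2 hlt
    rw [if_pos fun h => hlt.not_gt h.1, min_eq_right (pow_le_pow_left₀ hl.le haLU.le 2)]
    obtain ⟨G', h⟩ := decaysWithRate_normTail_sub hl haLU b b
    convert h.tendsto_deriv_logit using 3
    · rw [hpos, hpos]; congr 1; ring
    · ring
  have hl : l < 0 := lt_of_le_of_ne (not_lt.1 fun h => (hL'.1 h).not_gt hgt) hL0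
  rcases hU.lt_or_gt with hlt | hgt'
  · rw [if_neg (not_not.2 ⟨hgt, hlt⟩)]
    obtain ⟨G', h⟩ := decaysWithRate_normTail_add (hU'.2 hlt) (neg_pos.2 hl) b (-b)
    convert h.tendsto_deriv_logit_one_sub using 3
    · rw [hpos u, hneg l]; congr 1; ring
    · rw [neg_sq]; ring
  · have hu : u < 0 := lt_of_le_of_ne (not_lt.1 fun h => (hU'.1 h).not_gt hgt') hU0
    rw [if_pos fun h => hgt'.not_gt h.2, min_eq_left (by nlinarith)]
    obtain ⟨G', h⟩ := decaysWithRate_normTail_sub (neg_pos.2 hu) (neg_lt_neg haLU) (-b) (-b)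
    convert h.tendsto_deriv_logit using 3
    · rw [hneg, hneg]
    · ring
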